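/- Let F_1,...,F_n be in involution on ℝ^{2n}, y a corank-one critical point with relation Σ_α c_α ∇F_α(y) = 0, and Φ_t the flow of H = h(F). Then y_t = Φ_t(y) is also a corank-one critical point, the same coefficient vector works up to scale (Σ_α c_α ∇F_α(y_t) = 0 after suitable nonzero rescaling of c), and K(y_t) = S(y,t)·K(y)·S(y,t)^{-1} up to a nonzero scalar factor, where K(y) = Σ_α c_α J·F_α''(y) and S is the linearized flow. In particular τ = (1/2)Tr K² has the same sign along the orbit. -/

import Mathlib

open scoped BigOperators
open Sum

noncomputable section

/-- Phase space `ℝ^{2n}`: index `inl i` is the `q_i` (position) coordinate,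
`inr i` is the `p_i` (momentum) coordinate. -/
abbrev PS (n : ℕ) := (Fin n ⊕ Fin n) → ℝ

/-- Standard symplectic inner product `[z₁,z₂] = q₁·p₂ − p₁·q₂`. -/
def symp {n : ℕ} (u v : PS n) : ℝ :=
  (∑ i, u (inl i) * v (inr i)) - ∑ i, u (inr i) * v (inl i)

/-- Gradient of a function on phase space. -/
def grad {n : ℕ} (F : PS n → ℝ) (z : PS n) : PS n :=
  fun i => fderiv ℝ F z (Pi.single i 1)

/-- Standard Poisson bracket `{F,G} = ∇F·J·∇G`. -/
def poisson {n : ℕ} (F G : PS n → ℝ) (z : PS n) : ℝ :=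
  symp (grad F z) (grad G z)

/-- Standard symplectic matrix `J = [[0,I],[−I,0]]`. -/
def Jmat (n : ℕ) : Matrix (Fin n ⊕ Fin n) (Fin n ⊕ Fin n) ℝ :=
  Matrix.fromBlocks 0 1 (-1) 0

/-- Hamiltonian vector field `ξ = J·∇F`. -/
def ham {n : ℕ} (F : PS n → ℝ) (z : PS n) : PS n :=
  (Jmat n).mulVec (grad F z)

/-- Hessian matrix of second partial derivatives. -/
def hess {n : ℕ} (F : PS n → ℝ) (z : PS n) :
    Matrix (Fin n ⊕ Fin n) (Fin n ⊕ Fin n) ℝ :=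
  fun i j => fderiv ℝ (fun w => fderiv ℝ F w (Pi.single j 1)) z (Pi.single i 1)

/-- `K_c(z) = Σ_α c_α J·F_α''(z)`. -/
def Kc {n : ℕ} (F : Fin n → PS n → ℝ) (c : Fin n → ℝ) (z : PS n) :
    Matrix (Fin n ⊕ Fin n) (Fin n ⊕ Fin n) ℝ :=
  ∑ α, c α • (Jmat n * hess (F α) z)

section Flow

open Set Metric Filter Topology NNReal

variable {E : Type*} [NormedAddCommGroup E] [NormedSpace ℝ E]

/-- A continuous curve is bounded on a compact time interval. -/
theorem exists_norm_le_on_Icc {E : Type*} [NormedAddCommGroup E] {f : ℝ → E} (hf : Continuous f) (a b : ℝ) :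
    ∃ R : ℝ, ∀ s ∈ Icc a b, ‖f s‖ ≤ R :=
  isCompact_Icc.exists_bound_of_continuousOn hf.continuousOn

/-- Two global integral curves of a `C¹` vector field that agree at one time are equal. -/
theorem integralCurve_unique [FiniteDimensional ℝ E] {V : E → E} (hV : ContDiff ℝ 1 V)
    {f g : ℝ → E} (hf : ∀ t, HasDerivAt f (V (f t)) t) (hg : ∀ t, HasDerivAt g (V (g t)) t)
    {t₀ : ℝ} (h : f t₀ = g t₀) : f = g := by
  have hfc : Continuous f := continuous_iff_continuousAt.2 fun t => (hf t).continuousAt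
  have hgc : Continuous g := continuous_iff_continuousAt.2 fun t => (hg t).continuousAt
  ext t
  obtain ⟨A, B, ht, ht₀⟩ : ∃ A B, t ∈ Ioo A B ∧ t₀ ∈ Ioo A B :=
    ⟨min t t₀ - 1, max t t₀ + 1, by grind, by grind⟩
  obtain ⟨R₁, hR₁⟩ := exists_norm_le_on_Icc hfc A B
  obtain ⟨R₂, hR₂⟩ := exists_norm_le_on_Icc hgc A B
  obtain ⟨K, hK⟩ := hV.contDiffOn.exists_lipschitzOnWith one_ne_zero
    (convex_closedBall (0 : E) (max R₁ R₂)) (isCompact_closedBall _ _)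
  refine ODE_solution_unique_of_mem_Ioo (v := fun _ => V)
    (s := fun _ => closedBall (0 : E) (max R₁ R₂)) (fun _ _ => hK) ht₀
    (fun s hs => ⟨hf s, ?_⟩) (fun s hs => ⟨hg s, ?_⟩) h ht
  · simpa using Or.inl (hR₁ s (Ioo_subset_Icc_self hs))
  · simpa using Or.inr (hR₂ s (Ioo_subset_Icc_self hs))

/-- A flow satisfies `Φ (-t) ∘ Φ t = id`. -/
theorem flow_neg_flow [FiniteDimensional ℝ E] {V : E → E} (hV : ContDiff ℝ 1 V)
    {Φ : ℝ → E → E} (hΦ0 : ∀ z, Φ 0 z = z)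
    (hΦ : ∀ t z, HasDerivAt (fun s => Φ s z) (V (Φ t z)) t) (t : ℝ) (z : E) :
    Φ (-t) (Φ t z) = z := by
  have key : (fun s => Φ s (Φ t z)) = fun s => Φ (s + t) z :=
    integralCurve_unique hV (fun s => hΦ s (Φ t z))
      (fun s => (hΦ (s + t) z).comp_add_const s t) (t₀ := 0) (by simp [hΦ0])
  simpa [hΦ0] using congrFun key (-t)

/-- Grönwall's inequality for an integral curve starting close to a given one, with the vector
field Lipschitz only on a unit neighbourhood of the given curve. -/
theorem dist_integralCurve_le {V : E → E} {T R : ℝ} {K : ℝ≥0}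
    (hK : LipschitzOnWith K V (closedBall 0 (R + 1))) {f g : ℝ → E}
    (hf : ∀ t, HasDerivAt f (V (f t)) t) (hg : ∀ t, HasDerivAt g (V (g t)) t)
    (hR : ∀ s ∈ Icc 0 T, ‖f s‖ ≤ R) (h : dist (g 0) (f 0) * Real.exp (K * T) < 1) :
    ∀ s ∈ Icc 0 T, dist (g s) (f s) ≤ dist (g 0) (f 0) * Real.exp (K * T) := by
  have hfc : Continuous f := continuous_iff_continuousAt.2 fun t => (hf t).continuousAt
  have hgc : Continuous g := continuous_iff_continuousAt.2 fun t => (hg t).continuousAt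
  have key : ∀ b ∈ Icc 0 T, (∀ s ∈ Ico 0 b, dist (g s) (f s) < 1) →
      dist (g b) (f b) ≤ dist (g 0) (f 0) * Real.exp (K * T) := by
    intro b hb hlt
    have hRb : ∀ s ∈ Ico 0 b, ‖f s‖ ≤ R := fun s hs => hR s ⟨hs.1, hs.2.le.trans hb.2⟩
    have := dist_le_of_trajectories_ODE_of_mem (v := fun _ => V)
      (s := fun _ => closedBall (0 : E) (R + 1)) (a := 0) (b := b) (fun _ _ => hK)
      hgc.continuousOn (fun s _ => (hg s).hasDerivWithinAt)
      (fun s hs => by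
        have h1 := hlt s hs
        have h2 := hRb s hs
        rw [dist_eq_norm] at h1
        have h3 := norm_le_norm_add_norm_sub' (g s) (f s)
        simp only [mem_closedBall, dist_zero_right]
        linarith)
      hfc.continuousOn (fun s _ => (hf s).hasDerivWithinAt)
      (fun s hs => by
        have h2 := hRb s hs
        simp only [mem_closedBall, dist_zero_right]
        linarith) le_rfl b ⟨hb.1, le_rfl⟩
    refine this.trans ?_
    gcongr
    linarith [hb.2]
  have hlt : ∀ s ∈ Icc 0 T, dist (g s) (f s) < 1 := by
    by_contra! hne
    have hcl : IsCompact (Icc 0 T ∩ {s | 1 ≤ dist (g s) (f s)}) :=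
      isCompact_Icc.inter_right (isClosed_le continuous_const (hgc.dist hfc))
    obtain ⟨b, hb, hmin⟩ := hcl.exists_isLeast hne
    refine absurd hb.2 (not_le.2 ((key b hb.1 fun s hs => ?_).trans_lt h))
    by_contra! hs'
    exact absurd (hmin ⟨⟨hs.1, hs.2.le.trans hb.1.2⟩, hs'⟩) (not_le.2 hs.2)
  exact fun b hb => key b hb fun s hs => hlt s ⟨hs.1, hs.2.le.trans hb.2⟩

theorem gronwallBound_zero_left (K ε x : ℝ) :
    gronwallBound 0 K ε x = ε * gronwallBound 0 K 1 x := by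
  unfold gronwallBound
  split_ifs <;> ring

/-- If `V` and `W` commute and `W` vanishes along the orbit of `y` under the flow of `V`, then for
`z` near `y` the flow carries `z + W z` to `Φ T z + W (Φ T z)` up to a quadratic error. -/
theorem flow_add_isBigO [FiniteDimensional ℝ E] {V W : E → E} (hV : ContDiff ℝ 2 V)
    (hW : ContDiff ℝ 1 W) (hcomm : ∀ x, fderiv ℝ V x (W x) = fderiv ℝ W x (V x))
    {Φ : ℝ → E → E} (hΦ0 : ∀ z, Φ 0 z = z)
    (hΦ : ∀ t z, HasDerivAt (fun s => Φ s z) (V (Φ t z)) t) {y : E}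
    (hWy : ∀ s, W (Φ s y) = 0) {T : ℝ} (hT : 0 ≤ T) :
    (fun z => Φ T z + W (Φ T z) - Φ T (z + W z)) =O[𝓝 y] fun z => ‖z - y‖ ^ 2 := by
  have hc : ∀ z, Continuous fun s => Φ s z := fun z =>
    continuous_iff_continuousAt.2 fun t => (hΦ t z).continuousAt
  obtain ⟨R, hR⟩ := exists_norm_le_on_Icc (hc y) 0 T
  have hconv := convex_closedBall (0 : E) (R + 1)
  have hcpt : IsCompact (closedBall (0 : E) (R + 1)) := isCompact_closedBall _ _
  obtain ⟨K, hK⟩ := hV.contDiffOn.exists_lipschitzOnWith two_ne_zero hconv hcpt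
  obtain ⟨L, hL⟩ := hW.contDiffOn.exists_lipschitzOnWith one_ne_zero hconv hcpt
  have hV' : ContDiff ℝ 1 (fderiv ℝ V) := hV.fderiv_right (by norm_num)
  obtain ⟨M, hM⟩ := hV'.contDiffOn.exists_lipschitzOnWith one_ne_zero hconv hcpt
  set e := Real.exp (K * T) with he
  have he0 : 0 < e := Real.exp_pos _
  have hWy0 : W y = 0 := by simpa [hΦ0] using hWy 0
  have ev1 : ∀ᶠ z in 𝓝 y, dist z y * e * (1 + L) < 1 := by
    have : ContinuousAt (fun z => dist z y * e * (1 + L)) y := by fun_prop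
    exact this.eventually_lt_const (by simp)
  have ev2 : ∀ᶠ z in 𝓝 y, dist (z + W z) y * e < 1 := by
    have hWc := hW.continuous
    have : ContinuousAt (fun z => dist (z + W z) y * e) y := by fun_prop
    exact this.eventually_lt_const (by simp [hWy0])
  refine Asymptotics.IsBigO.of_bound (M * (L * e) ^ 2 * gronwallBound 0 K 1 T) ?_
  filter_upwards [ev1, ev2] with z hz1 hz2
  have hd : 0 ≤ dist z y * e := by positivity
  have hz3 : dist z y * e < 1 := by nlinarith [L.2, mul_nonneg hd L.2]
  have close1 : ∀ s ∈ Icc 0 T, dist (Φ s z) (Φ s y) ≤ dist z y * e := by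
    simpa [hΦ0] using dist_integralCurve_le hK (fun t => hΦ t y) (fun t => hΦ t z) hR
      (by simpa [hΦ0] using hz3)
  have close2 : ∀ s ∈ Icc 0 T, dist (Φ s (z + W z)) (Φ s y) ≤ dist (z + W z) y * e := by
    simpa [hΦ0] using dist_integralCurve_le hK (fun t => hΦ t y) (fun t => hΦ t (z + W z)) hR
      (by simpa [hΦ0] using hz2)
  have mem_of : ∀ s ∈ Icc 0 T, ∀ x, dist x (Φ s y) ≤ 1 → x ∈ closedBall (0 : E) (R + 1) := by
    intro s hs x hx
    rw [dist_eq_norm] at hx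
    have h3 := norm_le_norm_add_norm_sub' x (Φ s y)
    have := hR s hs
    simp only [mem_closedBall, dist_zero_right]
    linarith
  have mem1 : ∀ s ∈ Icc 0 T, Φ s z ∈ closedBall (0 : E) (R + 1) := fun s hs =>
    mem_of s hs _ ((close1 s hs).trans hz3.le)
  have memy : ∀ s ∈ Icc 0 T, Φ s y ∈ closedBall (0 : E) (R + 1) := fun s hs =>
    mem_of s hs _ (by simp)
  have hWz : ∀ s ∈ Icc 0 T, ‖W (Φ s z)‖ ≤ L * (dist z y * e) := fun s hs => by
    have := hL.dist_le_mul _ (mem1 s hs) _ (memy s hs)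
    rw [hWy, dist_zero_right] at this
    exact this.trans (by gcongr; exact close1 s hs)
  have mem3 : ∀ s ∈ Icc 0 T, Φ s z + W (Φ s z) ∈ closedBall (0 : E) (R + 1) := fun s hs =>
    mem_of s hs _ <| by
      have h1 := hWz s hs
      have h2 := close1 s hs
      have h3 := norm_add_le (Φ s z - Φ s y) (W (Φ s z))
      rw [dist_eq_norm] at h2 ⊢
      rw [add_sub_right_comm]
      nlinarith
  have hder : ∀ s, HasDerivAt (fun s => Φ s z + W (Φ s z))
      (V (Φ s z) + fderiv ℝ W (Φ s z) (V (Φ s z))) s := fun s =>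
    (hΦ s z).add (((hW.differentiable one_ne_zero _).hasFDerivAt).comp_hasDerivAt s (hΦ s z))
  have quad : ∀ s ∈ Icc 0 T, dist (V (Φ s z) + fderiv ℝ W (Φ s z) (V (Φ s z)))
      (V (Φ s z + W (Φ s z))) ≤ M * (L * (dist z y * e)) ^ 2 := by
    intro s hs
    have hseg : segment ℝ (Φ s z) (Φ s z + W (Φ s z)) ⊆ closedBall (0 : E) (R + 1) :=
      hconv.segment_subset (mem1 s hs) (mem3 s hs)
    have h1 := (convex_segment (𝕜 := ℝ) (Φ s z)
      (Φ s z + W (Φ s z))).norm_image_sub_le_of_norm_fderiv_le' (𝕜 := ℝ)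
      (f := V) (φ := fderiv ℝ V (Φ s z)) (C := M * ‖W (Φ s z)‖)
      (fun x _ => hV.differentiable two_ne_zero x)
      (fun x hx => by
        have h2 := hM.dist_le_mul _ (hseg hx) _ (mem1 s hs)
        rw [dist_eq_norm, dist_eq_norm] at h2
        refine h2.trans ?_
        gcongr
        simpa using norm_sub_le_of_mem_segment hx)
      (left_mem_segment _ _ _) (right_mem_segment _ _ _)
    rw [← hcomm, dist_comm, dist_eq_norm]
    rw [add_sub_cancel_left] at h1
    rw [← sub_sub]
    refine h1.trans ?_
    rw [mul_assoc, ← sq]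
    gcongr
    exact hWz s hs
  have fin := dist_le_of_approx_trajectories_ODE_of_mem (v := fun _ => V)
    (s := fun _ => closedBall (0 : E) (R + 1)) (a := 0) (b := T) (δ := 0) (εg := 0)
    (g := fun s => Φ s (z + W z)) (fun _ _ => hK)
    (continuous_iff_continuousAt.2 fun t => (hder t).continuousAt).continuousOn
    (fun s _ => (hder s).hasDerivWithinAt) (fun s hs => quad s (Ico_subset_Icc_self hs))
    (fun s hs => mem3 s (Ico_subset_Icc_self hs))
    (hc _).continuousOn (fun s _ => (hΦ s _).hasDerivWithinAt) (fun _ _ => (dist_self _).le)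
    (fun s hs => mem_of s (Ico_subset_Icc_self hs) _
      ((close2 s (Ico_subset_Icc_self hs)).trans hz2.le))
    (by simp [hΦ0]) T ⟨hT, le_rfl⟩
  rw [gronwallBound_zero_left, dist_eq_norm, sub_zero, add_zero] at fin
  refine fin.trans (le_of_eq ?_)
  rw [dist_eq_norm, Real.norm_of_nonneg (by positivity)]
  ring

/-- If `V` and `W` commute and `W` vanishes along the orbit of `y` under the flow of `V`, then
the derivative of the flow intertwines the linearizations of `W` along the orbit, for
nonnegative times. -/
theorem fderiv_flow_comp_fderiv_of_nonneg [FiniteDimensional ℝ E] {V W : E → E}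
    (hV : ContDiff ℝ 2 V)
    (hW : ContDiff ℝ 1 W) (hcomm : ∀ x, fderiv ℝ V x (W x) = fderiv ℝ W x (V x))
    {Φ : ℝ → E → E} (hΦ0 : ∀ z, Φ 0 z = z)
    (hΦ : ∀ t z, HasDerivAt (fun s => Φ s z) (V (Φ t z)) t) {y : E}
    (hWy : ∀ s, W (Φ s y) = 0) {T : ℝ} (hT : 0 ≤ T) {S : E →L[ℝ] E}
    (hS : HasFDerivAt (Φ T) S y) :
    (fderiv ℝ W (Φ T y)).comp S = S.comp (fderiv ℝ W y) := by
  have hWy0 : W y = 0 := by simpa [hΦ0] using hWy 0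
  have hWd : ∀ x, HasFDerivAt W (fderiv ℝ W x) x := fun x =>
    (hW.differentiable one_ne_zero x).hasFDerivAt
  have h1 := (flow_add_isBigO hV hW hcomm hΦ0 hΦ hWy hT).hasFDerivAt (𝕜 := ℝ) one_lt_two
  have hid : HasFDerivAt (fun z => z + W z) (ContinuousLinearMap.id ℝ E + fderiv ℝ W y) y :=
    (hasFDerivAt_id y).add (hWd y)
  have hS' : HasFDerivAt (Φ T) S (y + W y) := by simpa [hWy0] using hS
  have h2 := (hS.add ((hWd _).comp y hS)).sub (hS'.comp y hid)
  have h3 := h2.unique h1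
  ext v
  have h4 := congrArg (fun A : E →L[ℝ] E => A v) h3
  simp only [sub_apply, add_apply, ContinuousLinearMap.comp_apply, map_add,
    ContinuousLinearMap.id_apply, zero_apply] at h4
  rw [add_sub_add_left_eq_sub, sub_eq_zero] at h4
  exact h4

/-- If `V` and `W` commute and `W` vanishes along the orbit of `y` under the flow of `V`, then
the derivative of the flow intertwines the linearizations of `W` along the orbit. -/
theorem fderiv_flow_comp_fderiv [FiniteDimensional ℝ E] {V W : E → E} (hV : ContDiff ℝ 2 V)
    (hW : ContDiff ℝ 1 W) (hcomm : ∀ x, fderiv ℝ V x (W x) = fderiv ℝ W x (V x))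
    {Φ : ℝ → E → E} (hΦ0 : ∀ z, Φ 0 z = z)
    (hΦ : ∀ t z, HasDerivAt (fun s => Φ s z) (V (Φ t z)) t) {y : E}
    (hWy : ∀ s, W (Φ s y) = 0) {T : ℝ} {S : E →L[ℝ] E} (hS : HasFDerivAt (Φ T) S y) :
    (fderiv ℝ W (Φ T y)).comp S = S.comp (fderiv ℝ W y) := by
  rcases le_total 0 T with hT | hT
  · exact fderiv_flow_comp_fderiv_of_nonneg hV hW hcomm hΦ0 hΦ hWy hT hS
  · have := fderiv_flow_comp_fderiv_of_nonneg (V := fun x => -V x) (Φ := fun t => Φ (-t))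
      (y := y) (T := -T) (S := S) hV.neg hW (fun x => by simp [fderiv_fun_neg, hcomm])
      (by simpa using hΦ0)
      (fun t z => by simpa [Function.comp_def] using (hΦ (-t) z).scomp t (hasDerivAt_neg t))
      (fun s => hWy (-s)) (by linarith) (by simpa using hS)
    simpa using this

end Flow

section Symplectic

variable {n : ℕ}

open Matrix

theorem fderiv_apply_eq_grad_dotProduct (F : PS n → ℝ) (z v : PS n) :
    fderiv ℝ F z v = grad F z ⬝ᵥ v := by
  conv_lhs => rw [pi_eq_sum_univ' v]
  simp [grad, dotProduct, mul_comm]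

theorem symp_eq_dotProduct (u v : PS n) : symp u v = u ⬝ᵥ Jmat n *ᵥ v := by
  simp [symp, Jmat, dotProduct, Fintype.sum_sum_type, mulVec, fromBlocks, one_apply,
    sub_eq_add_neg]

theorem Jmat_transpose : (Jmat n)ᵀ = -Jmat n := by
  simp [Jmat, fromBlocks_transpose, fromBlocks_neg]

/-- The Jacobian of the gradient is the Hessian. -/
theorem hasFDerivAt_grad {F : PS n → ℝ} (hF : ContDiff ℝ (⊤ : ℕ∞) F) (z : PS n) :
    HasFDerivAt (grad F) (LinearMap.toContinuousLinearMap (hess F z).mulVecLin) z := by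
  have hd : ContDiff ℝ (⊤ : ℕ∞) (fderiv ℝ F) := hF.fderiv_right (by simp)
  have hdd : Differentiable ℝ (fderiv ℝ F) := hd.differentiable (by simp)
  have hsymm : IsSymmSndFDerivAt ℝ F z :=
    hF.contDiffAt.isSymmSndFDerivAt (by simpa using WithTop.coe_le_coe.2 (le_top : (2 : ℕ∞) ≤ ⊤))
  have happ : ∀ w x : PS n, HasFDerivAt (fun x => fderiv ℝ F x w)
      ((fderiv ℝ (fderiv ℝ F) x).flip w) x := fun w x => by
    simpa using (hdd x).hasFDerivAt.clm_apply (hasFDerivAt_const w x)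
  rw [hasFDerivAt_pi']
  intro i
  refine (happ (Pi.single i 1) z).congr_fderiv (ContinuousLinearMap.ext fun v => ?_)
  have hh : ∀ j, hess F z i j = fderiv ℝ (fderiv ℝ F) z (Pi.single i 1) (Pi.single j 1) :=
    fun j => by simp [hess, (happ _ z).fderiv]
  have : fderiv ℝ (fderiv ℝ F) z (Pi.single i 1) v = ∑ j, hess F z i j * v j := by
    conv_lhs => rw [pi_eq_sum_univ' v]
    simp [hh, mul_comm]
  simp [mulVec, dotProduct, ← this, hsymm.eq v]

theorem contDiff_grad {F : PS n → ℝ} (hF : ContDiff ℝ (⊤ : ℕ∞) F) :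
    ContDiff ℝ (⊤ : ℕ∞) (grad F) :=
  contDiff_pi.2 fun _ => (hF.fderiv_right (by simp)).clm_apply contDiff_const

theorem hess_transpose {F : PS n → ℝ} (hF : ContDiff ℝ (⊤ : ℕ∞) F) (z : PS n) :
    (hess F z)ᵀ = hess F z := by
  ext i j
  have h := hasFDerivAt_pi'.1 (hasFDerivAt_grad hF z) i
  rw [transpose_apply]
  change fderiv ℝ (fun w => grad F w i) z (Pi.single j 1) = _
  simp [h.fderiv]

theorem ham_eq_mulVecLin_comp (F : PS n → ℝ) :
    ham F = LinearMap.toContinuousLinearMap (Jmat n).mulVecLin ∘ grad F := rfl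

theorem contDiff_ham {F : PS n → ℝ} (hF : ContDiff ℝ (⊤ : ℕ∞) F) :
    ContDiff ℝ (⊤ : ℕ∞) (ham F) := by
  rw [ham_eq_mulVecLin_comp]
  exact (ContinuousLinearMap.contDiff _).comp (contDiff_grad hF)

/-- The Jacobian of the Hamiltonian vector field of `F` is `J F''`. -/
theorem hasFDerivAt_ham {F : PS n → ℝ} (hF : ContDiff ℝ (⊤ : ℕ∞) F) (z : PS n) :
    HasFDerivAt (ham F)
      (LinearMap.toContinuousLinearMap (Jmat n * hess F z).mulVecLin) z := by
  refine ((LinearMap.toContinuousLinearMap (Jmat n).mulVecLin).hasFDerivAt.comp z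
    (hasFDerivAt_grad hF z)).congr_fderiv (ContinuousLinearMap.ext fun v => ?_)
  simp

theorem fderiv_ham_apply {F : PS n → ℝ} (hF : ContDiff ℝ (⊤ : ℕ∞) F) (z v : PS n) :
    fderiv ℝ (ham F) z v = (Jmat n * hess F z) *ᵥ v := by
  simp [(hasFDerivAt_ham hF z).fderiv]

/-- Hamiltonian vector fields of functions in involution commute. -/
theorem fderiv_ham_comm {F G : PS n → ℝ} (hF : ContDiff ℝ (⊤ : ℕ∞) F)
    (hG : ContDiff ℝ (⊤ : ℕ∞) G) (h : ∀ z, poisson F G z = 0) (z : PS n) :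
    fderiv ℝ (ham F) z (ham G z) = fderiv ℝ (ham G) z (ham F z) := by
  have hd : HasFDerivAt (fun x => ∑ i, grad F x i * ham G x i) _ z :=
    HasFDerivAt.fun_sum fun i _ =>
      (hasFDerivAt_pi'.1 (hasFDerivAt_grad hF z) i).mul
        (hasFDerivAt_pi'.1 (hasFDerivAt_ham hG z) i)
  have h0 : (fun x => ∑ i, grad F x i * ham G x i) = fun _ => 0 := by
    ext x
    exact (symp_eq_dotProduct _ _).symm.trans (h x)
  rw [h0] at hd
  have hz := hd.unique (hasFDerivAt_const (0 : ℝ) z)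
  have hv : ∀ v, grad F z ⬝ᵥ (Jmat n * hess G z) *ᵥ v + ham G z ⬝ᵥ hess F z *ᵥ v = 0 := by
    intro v
    have := congrArg (fun A : PS n →L[ℝ] ℝ => A v) hz
    simpa [dotProduct, Finset.sum_add_distrib] using this
  have hvec : hess F z *ᵥ ham G z = hess G z *ᵥ ham F z := by
    have h1 : hess F z *ᵥ ham G z - hess G z *ᵥ ham F z = 0 := by
      refine dotProduct_eq_zero _ fun v => ?_
      have h2 := hv v
      rw [dotProduct_mulVec, dotProduct_mulVec, ← vecMul_vecMul, ← mulVec_transpose (hess F z),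
        ← mulVec_transpose (hess G z), ← mulVec_transpose (Jmat n), Jmat_transpose,
        hess_transpose hF, hess_transpose hG, neg_mulVec, mulVec_neg, neg_dotProduct] at h2
      rw [sub_dotProduct]
      unfold ham at h2 ⊢
      linarith
    exact sub_eq_zero.1 h1
  rw [fderiv_ham_apply hF, fderiv_ham_apply hG, ← mulVec_mulVec, ← mulVec_mulVec, hvec]

theorem grad_comp {F : Fin n → PS n → ℝ} (hF : ∀ α, ContDiff ℝ (⊤ : ℕ∞) (F α))
    {h : (Fin n → ℝ) → ℝ} (hh : ContDiff ℝ (⊤ : ℕ∞) h) (z : PS n) :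
    grad (fun z => h fun α => F α z) z =
      ∑ α, fderiv ℝ h (fun α => F α z) (Pi.single α 1) • grad (F α) z := by
  have hd : HasFDerivAt (fun z => fun α => F α z)
      (ContinuousLinearMap.pi fun α => fderiv ℝ (F α) z) z :=
    hasFDerivAt_pi.2 fun α => ((hF α).differentiable (by simp) z).hasFDerivAt
  have hc := ((hh.differentiable (by simp) _).hasFDerivAt (x := fun α => F α z)).comp z hd
  ext i
  have : grad (fun z => h fun α => F α z) z i =
      fderiv ℝ h (fun α => F α z) (fun α => fderiv ℝ (F α) z (Pi.single i 1)) := by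
    simp only [grad]
    rw [show (fun z => h fun α => F α z) = h ∘ fun z α => F α z from rfl, hc.fderiv]
    rfl
  rw [this, pi_eq_sum_univ' (fun α => fderiv ℝ (F α) z (Pi.single i 1))]
  simp [grad, mul_comm]

/-- A function of functions in involution is in involution with each of them. -/
theorem poisson_comp_eq_zero {F : Fin n → PS n → ℝ} (hF : ∀ α, ContDiff ℝ (⊤ : ℕ∞) (F α))
    (hinv : ∀ α β, ∀ z : PS n, poisson (F α) (F β) z = 0)
    {h : (Fin n → ℝ) → ℝ} (hh : ContDiff ℝ (⊤ : ℕ∞) h) (β : Fin n) (z : PS n) :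
    poisson (fun z => h fun α => F α z) (F β) z = 0 := by
  simp only [poisson, symp_eq_dotProduct] at hinv ⊢
  rw [grad_comp hF hh, sum_dotProduct]
  simp [hinv]

theorem symp_swap (u v : PS n) : symp u v = -symp v u := by
  simp [symp, mul_comm]

/-- A function in involution with `H` is constant along integral curves of `ham H`. -/
theorem comp_integralCurve_eq {F H : PS n → ℝ} (hF : Differentiable ℝ F)
    (h : ∀ z, poisson H F z = 0) {γ : ℝ → PS n} (hγ : ∀ t, HasDerivAt γ (ham H (γ t)) t)
    (t : ℝ) : F (γ t) = F (γ 0) := by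
  have hd : ∀ s, HasDerivAt (fun s => F (γ s)) 0 s := fun s => by
    have := (hF (γ s)).hasFDerivAt.comp_hasDerivAt s (hγ s)
    rwa [fderiv_apply_eq_grad_dotProduct, ham, ← symp_eq_dotProduct, symp_swap,
      show symp (grad H (γ s)) (grad F (γ s)) = 0 from h _, neg_zero] at this
  exact is_const_of_deriv_eq_zero (fun s => (hd s).differentiableAt) (fun s => (hd s).deriv) t 0

/-- Gradients of invariants are pulled back by the transpose of the Jacobian. -/
theorem transpose_mulVec_grad {F : PS n → ℝ} (hF : Differentiable ℝ F) {φ : PS n → PS n}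
    (hφ : ∀ z, F (φ z) = F z) {z : PS n} {S : Matrix (Fin n ⊕ Fin n) (Fin n ⊕ Fin n) ℝ}
    (hS : HasFDerivAt φ (LinearMap.toContinuousLinearMap S.mulVecLin) z) :
    Sᵀ *ᵥ grad F (φ z) = grad F z := by
  have h1 := (hF (φ z)).hasFDerivAt.comp z hS
  have h2 : F ∘ φ = F := funext hφ
  rw [h2] at h1
  refine dotProduct_eq _ _ fun v => ?_
  rw [← fderiv_apply_eq_grad_dotProduct F z v, h1.fderiv]
  simp [fderiv_apply_eq_grad_dotProduct, mulVec_transpose, dotProduct_mulVec]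

end Symplectic

section Invariance

variable {n : ℕ}

open Matrix

/-- Jacobians of mutually inverse maps are mutually inverse. -/
theorem jacobian_mul_eq_one {ι : Type*} [Fintype ι] [DecidableEq ι] {φ ψ : (ι → ℝ) → (ι → ℝ)}
    (h : ∀ z, ψ (φ z) = z)
    {z : ι → ℝ} {A B : Matrix ι ι ℝ}
    (hφ : HasFDerivAt φ (LinearMap.toContinuousLinearMap A.mulVecLin) z)
    (hψ : HasFDerivAt ψ (LinearMap.toContinuousLinearMap B.mulVecLin) (φ z)) : B * A = 1 := by
  have h1 := hψ.comp z hφ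
  rw [show ψ ∘ φ = id from funext h] at h1
  have h2 := h1.unique (hasFDerivAt_id z)
  refine ext_of_mulVec_single fun i => ?_
  rw [← mulVec_mulVec, one_mulVec]
  simpa using congrArg (fun L : (ι → ℝ) →L[ℝ] (ι → ℝ) => L (Pi.single i 1)) h2

theorem hasFDerivAt_sum_ham {F : Fin n → PS n → ℝ} (hF : ∀ α, ContDiff ℝ (⊤ : ℕ∞) (F α))
    (c : Fin n → ℝ) (z : PS n) :
    HasFDerivAt (fun z => ∑ α, c α • ham (F α) z)
      (LinearMap.toContinuousLinearMap (Kc F c z).mulVecLin) z := by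
  refine (HasFDerivAt.fun_sum fun α _ => (hasFDerivAt_ham (hF α) z).const_smul
    (c α)).congr_fderiv (ContinuousLinearMap.ext fun v => ?_)
  simp [Kc]

theorem trace_mul_self_eq_of_conj {ι : Type*} [Fintype ι] [DecidableEq ι]
    {K K' S S' : Matrix ι ι ℝ} (hS : S' * S = 1) (h : K' * S = S * K) :
    (K' * K').trace = (K * K).trace := by
  have hS' : S * S' = 1 := mul_eq_one_comm.1 hS
  have hK : K' = S * K * S' := by rw [← h, mul_assoc, hS', mul_one]
  rw [hK, show S * K * S' * (S * K * S') = S * K * (S' * S) * (K * S') by simp only [mul_assoc],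
    hS, mul_one, mul_assoc, trace_mul_comm]
  rw [mul_assoc, mul_assoc, hS, mul_one]

end Invariance

/-- corank-one critical points are carried to corank-one critical points
by the flow of `H = h(F)`; the coefficient vector `c` of the linear relation persists
up to a nonzero rescaling; `K` evolves by conjugation by the linearized flow up to a
nonzero scalar factor; and the sign of `τ = ½ Tr K²` is constant along the orbit. -/
theorem stmt13 {n : ℕ} (F : Fin n → PS n → ℝ)
    (hF : ∀ α, ContDiff ℝ (⊤ : ℕ∞) (F α))
    (hinv : ∀ α β, ∀ z : PS n, poisson (F α) (F β) z = 0)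
    (h : (Fin n → ℝ) → ℝ) (hh : ContDiff ℝ (⊤ : ℕ∞) h)
    (H : PS n → ℝ) (hH : ∀ z, H z = h (fun α => F α z))
    (y : PS n) (c : Fin n → ℝ) (hc : c ≠ 0)
    (hrel : ∑ α, c α • grad (F α) y = 0)
    (hcorank :
      Module.finrank ℝ (Submodule.span ℝ (Set.range fun α => grad (F α) y)) = n - 1)
    (Φ : ℝ → PS n → PS n)
    (hΦ0 : ∀ z, Φ 0 z = z)
    (hΦ : ∀ (t : ℝ) (z : PS n), HasDerivAt (fun s => Φ s z) (ham H (Φ t z)) t)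
    (S : PS n → ℝ → Matrix (Fin n ⊕ Fin n) (Fin n ⊕ Fin n) ℝ)
    (hS : ∀ (t : ℝ) (z : PS n),
      HasFDerivAt (Φ t) (LinearMap.toContinuousLinearMap (S z t).mulVecLin) z) :
    ∀ t : ℝ,
      Module.finrank ℝ
        (Submodule.span ℝ (Set.range fun α => grad (F α) (Φ t y))) = n - 1 ∧
      (∃ d : ℝ, d ≠ 0 ∧ ∑ α, (d * c α) • grad (F α) (Φ t y) = 0) ∧
      (∃ e : ℝ, e ≠ 0 ∧
        Kc F c (Φ t y) * S y t = e • (S y t * Kc F c y)) ∧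
      Real.sign ((1 / 2 : ℝ) * (Kc F c (Φ t y) * Kc F c (Φ t y)).trace) =
        Real.sign ((1 / 2 : ℝ) * (Kc F c y * Kc F c y).trace) := by
  obtain rfl : H = fun z => h fun α => F α z := funext hH
  intro t
  have hHs : ContDiff ℝ (⊤ : ℕ∞) fun z => h fun α => F α z := hh.comp (contDiff_pi.2 hF)
  have hHF := poisson_comp_eq_zero hF hinv hh
  have hV := contDiff_ham hHs
  have hcons : ∀ α t z, F α (Φ t z) = F α z := fun α t z => by
    simpa [hΦ0] using comp_integralCurve_eq ((hF α).differentiable (by simp)) (hHF α)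
      (fun s => hΦ s z) t
  have hSS : ∀ s, S (Φ s y) (-s) * S y s = 1 := fun s =>
    jacobian_mul_eq_one (flow_neg_flow (hV.of_le (by simp)) hΦ0 hΦ s) (hS s y) (hS (-s) _)
  have hgrad : ∀ s α, grad (F α) (Φ s y) = (S (Φ s y) (-s)).transpose.mulVec (grad (F α) y) := by
    intro s α
    rw [← transpose_mulVec_grad ((hF α).differentiable (by simp)) (hcons α s) (hS s y),
      Matrix.mulVec_mulVec, ← Matrix.transpose_mul, mul_eq_one_comm.1 (hSS s)]
    simp
  have hrel' : ∀ s, ∑ α, c α • grad (F α) (Φ s y) = 0 := fun s => by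
    simp only [hgrad, ← Matrix.mulVec_smul]
    rw [← Matrix.mulVec_sum, hrel, Matrix.mulVec_zero]
  have hW0 : ∀ s, ∑ α, c α • ham (F α) (Φ s y) = 0 := fun s => by
    simp only [ham, ← Matrix.mulVec_smul]
    rw [← Matrix.mulVec_sum, hrel', Matrix.mulVec_zero]
  have hWs : ContDiff ℝ (⊤ : ℕ∞) fun z => ∑ α, c α • ham (F α) z :=
    ContDiff.sum fun α _ => (contDiff_ham (hF α)).const_smul (c α)
  have hcomm : ∀ x, fderiv ℝ (ham fun z => h fun α => F α z) x (∑ α, c α • ham (F α) x) =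
      fderiv ℝ (fun z => ∑ α, c α • ham (F α) z) x (ham (fun z => h fun α => F α z) x) := by
    intro x
    simp only [map_sum, map_smul, fderiv_ham_comm hHs (hF _) (hHF _), fderiv_ham_apply (hF _),
      (hasFDerivAt_sum_ham hF c x).fderiv]
    simp [Kc]
  have hK : Kc F c (Φ t y) * S y t = S y t * Kc F c y := by
    have hint := fderiv_flow_comp_fderiv (hV.of_le (WithTop.coe_le_coe.2 (le_top : (2 : ℕ∞) ≤ ⊤)))
      (hWs.of_le (by simp)) hcomm hΦ0 hΦ hW0 (hS t y)
    rw [(hasFDerivAt_sum_ham hF c _).fderiv, (hasFDerivAt_sum_ham hF c _).fderiv] at hint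
    refine Matrix.ext_of_mulVec_single fun i => ?_
    rw [← Matrix.mulVec_mulVec, ← Matrix.mulVec_mulVec]
    simpa using congrArg (fun L : PS n →L[ℝ] PS n => L (Pi.single i 1)) hint
  refine ⟨?_, ⟨1, one_ne_zero, by simpa using hrel' t⟩, ⟨1, one_ne_zero, by simpa using hK⟩, ?_⟩
  · have hinj : Function.Injective (S (Φ t y) (-t)).transpose.mulVecLin := by
      refine Function.LeftInverse.injective (g := (S y t).transpose.mulVec) fun v => ?_
      rw [Matrix.mulVecLin_apply, Matrix.mulVec_mulVec, ← Matrix.transpose_mul, hSS]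
      simp
    rw [show (fun α => grad (F α) (Φ t y)) = (S (Φ t y) (-t)).transpose.mulVecLin ∘
      fun α => grad (F α) y from funext (hgrad t), ← hcorank, ((Submodule.span ℝ (Set.range fun α => grad (F α) y)).equivMapOfInjective _
      hinj).finrank_eq, Submodule.map_span, ← Set.range_comp]
  · rw [trace_mul_self_eq_of_conj (hSS t) hK]
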